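/- Let 𝒞 be a clutter with incidence matrix A having columns v_1,…,v_q ∈ {0,1}^n, let I = I(𝒞) ⊆ R = K[x_1,…,x_n] be its edge ideal, and let 𝔭_1,…,𝔭_s be the minimal primes of I. Then the set covering polyhedron Q(A) is an integral polyhedron if and only if for every i ≥ 1 the integral closure of I^i equals the i-th symbolic power, i.e., the ideal generated by the monomials x^a (a ∈ ℕ^n) such that (x^a)^p ∈ I^{pi} for some p ≥ 1 equals I^{(i)} = 𝔭_1^i ∩ ⋯ ∩ 𝔭_s^i. -/

import Mathlib

open Finset

/-- The family `E` of edges (indexed by `Fin q`) is a clutter on the vertex set `Fin n`: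
edges are nonempty and none of them is included in another. -/
def IsClutter {n q : ℕ} (E : Fin q → Finset (Fin n)) : Prop :=
  (∀ j, (E j).Nonempty) ∧ ∀ j j' : Fin q, E j ⊆ E j' → j = j'

/-- The columns `v₁, …, v_q ∈ {0,1}ⁿ` of the incidence matrix of the clutter with edges `E`:
the characteristic vectors of the edges. -/
def incidence {n q : ℕ} (E : Fin q → Finset (Fin n)) : Fin q → Fin n → ℝ :=
  fun j i => if i ∈ E j then 1 else 0

/-- A vector is integral if all its entries are integers. -/
def IsIntegralVec {m : ℕ} (x : Fin m → ℝ) : Prop := ∀ i, ∃ z : ℤ, x i = z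

/-- The set covering polyhedron `Q(A) = {x ∈ ℝⁿ | x ≥ 0, xA ≥ 1}`. -/
def coveringPolyhedron {n q : ℕ} (v : Fin q → Fin n → ℝ) : Set (Fin n → ℝ) :=
  {x | (∀ i, 0 ≤ x i) ∧ ∀ j, 1 ≤ ∑ i, x i * v j i}

/-- `Q(A)` is an integral polyhedron: all its vertices (extreme points) have integer
coordinates. -/
def IntegralPolyhedron {n q : ℕ} (v : Fin q → Fin n → ℝ) : Prop :=
  ∀ x ∈ Set.extremePoints ℝ (coveringPolyhedron v), IsIntegralVec x

/-- The clutter with edges `E` has the max-flow min-cut property: for every `α ∈ ℕⁿ`, both the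
linear program `min {⟨α,x⟩ | x ≥ 0, xA ≥ 1}` and its dual `max {⟨y,1⟩ | y ≥ 0, Ay ≤ α}` have
integral optimal solutions. -/
def HasMFMC {n q : ℕ} (E : Fin q → Finset (Fin n)) : Prop :=
  ∀ α : Fin n → ℕ,
    (∃ x : Fin n → ℝ, IsIntegralVec x ∧ (∀ i, 0 ≤ x i) ∧
      (∀ j, 1 ≤ ∑ i, x i * incidence E j i) ∧
      ∀ x' : Fin n → ℝ, (∀ i, 0 ≤ x' i) → (∀ j, 1 ≤ ∑ i, x' i * incidence E j i) →
        ∑ i, (α i : ℝ) * x i ≤ ∑ i, (α i : ℝ) * x' i) ∧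
    (∃ y : Fin q → ℝ, IsIntegralVec y ∧ (∀ j, 0 ≤ y j) ∧
      (∀ i, ∑ j, y j * incidence E j i ≤ α i) ∧
      ∀ y' : Fin q → ℝ, (∀ j, 0 ≤ y' j) → (∀ i, ∑ j, y' j * incidence E j i ≤ α i) →
        ∑ j, y' j ≤ ∑ j, y j)

/-- The Rees cone `ℝ₊𝒜′ ⊆ ℝ^{n+1}`: the set of all nonnegative real linear combinations of
`𝒜′ = {e₁, …, eₙ, (v₁,1), …, (v_q,1)}`. -/
def reesCone {n q : ℕ} (v : Fin q → Fin n → ℝ) : Set (Fin (n + 1) → ℝ) :=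
  {x | ∃ (a : Fin n → ℝ) (b : Fin q → ℝ), (∀ i, 0 ≤ a i) ∧ (∀ j, 0 ≤ b j) ∧
    x = (∑ i, a i • (Pi.single (Fin.castSucc i) 1 : Fin (n + 1) → ℝ)) +
        ∑ j, b j • (Fin.snoc (v j) 1 : Fin (n + 1) → ℝ)}

/-- The affine semigroup `ℕ𝒜′ ⊆ ℝ^{n+1}`: all linear combinations of
`𝒜′ = {e₁, …, eₙ, (v₁,1), …, (v_q,1)}` with nonnegative integer coefficients. -/
def reesSemigroup {n q : ℕ} (v : Fin q → Fin n → ℝ) : Set (Fin (n + 1) → ℝ) :=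
  {x | ∃ (a : Fin n → ℕ) (b : Fin q → ℕ),
    x = (∑ i, (a i : ℝ) • (Pi.single (Fin.castSucc i) 1 : Fin (n + 1) → ℝ)) +
        ∑ j, (b j : ℝ) • (Fin.snoc (v j) 1 : Fin (n + 1) → ℝ)}

/-- `ℕ𝒜′ = ℤ^{n+1} ∩ ℝ₊𝒜′`; equivalently, the Rees algebra `R[It]` is a normal domain. -/
def NormalReesAlgebra {n q : ℕ} (v : Fin q → Fin n → ℝ) : Prop :=
  reesSemigroup v = {x ∈ reesCone v | IsIntegralVec x}

/-- The `i`-th symbolic power `I^{(i)} = 𝔭₁ⁱ ∩ ⋯ ∩ 𝔭_sⁱ` of an ideal `I` with minimal primes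
`𝔭₁, …, 𝔭_s`. -/
def symbolicPower {R : Type*} [CommRing R] (I : Ideal R) (i : ℕ) : Ideal R :=
  ⨅ p ∈ I.minimalPrimes, p ^ i

/-- The integral closure of the `i`-th power of a monomial ideal `I`: the ideal generated by
the monomials `x^a` (`a ∈ ℕⁿ`) such that `(x^a)^p ∈ I^{pi}` for some `p ≥ 1`. -/
noncomputable def monomialIntClosure {n : ℕ} {K : Type*} [Field K]
    (I : Ideal (MvPolynomial (Fin n) K)) (i : ℕ) : Ideal (MvPolynomial (Fin n) K) :=
  Ideal.span {m | ∃ a : Fin n →₀ ℕ, m = MvPolynomial.monomial a (1 : K) ∧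
    ∃ p : ℕ, 1 ≤ p ∧ m ^ p ∈ I ^ (p * i)}

/-- The ideal of the polynomials all of whose monomials have weight at least `t`, for the
nonnegative weights `w` of the variables. -/
def weightIdeal {σ : Type*} [Fintype σ] (K : Type*) [Field K] (w : σ → ℝ) (hw : ∀ i, 0 ≤ w i)
    (t : ℝ) : Ideal (MvPolynomial σ K) where
  carrier := {f | ∀ m ∈ f.support, t ≤ ∑ i, (m i : ℝ) * w i}
  add_mem' := by
    classical
    intro f g hf hg m hm
    rcases Finset.mem_union.1 (MvPolynomial.support_add hm) with h | h
    exacts [hf m h, hg m h]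
  zero_mem' := by simp
  smul_mem' := by
    classical
    intro f g hg m hm
    obtain ⟨a, -, b, hb, rfl⟩ := Finset.mem_add.1 (MvPolynomial.support_mul f g hm)
    refine (hg b hb).trans (Finset.sum_le_sum fun i _ => ?_)
    have := hw i
    gcongr
    simp

section weightIdeal

variable {σ : Type*} [Fintype σ] {K : Type*} [Field K] {w : σ → ℝ} {hw : ∀ i, 0 ≤ w i}

theorem mem_weightIdeal {t : ℝ} {f : MvPolynomial σ K} :
    f ∈ weightIdeal K w hw t ↔ ∀ m ∈ f.support, t ≤ ∑ i, (m i : ℝ) * w i := Iff.rfl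

theorem monomial_mem_weightIdeal {t : ℝ} {m : σ →₀ ℕ} :
    MvPolynomial.monomial m (1 : K) ∈ weightIdeal K w hw t ↔ t ≤ ∑ i, (m i : ℝ) * w i := by
  classical
  simp [mem_weightIdeal, MvPolynomial.support_monomial]

theorem weightIdeal_mul_le (s t : ℝ) :
    weightIdeal K w hw s * weightIdeal K w hw t ≤ weightIdeal K w hw (s + t) := by
  classical
  refine Ideal.mul_le.2 fun f hf g hg m hm => ?_
  obtain ⟨a, ha, b, hb, rfl⟩ := Finset.mem_add.1 (MvPolynomial.support_mul f g hm)
  have h1 := hf a ha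
  have h2 := hg b hb
  simp only [Finsupp.add_apply, Nat.cast_add, add_mul, Finset.sum_add_distrib]
  linarith

theorem pow_le_weightIdeal {J : Ideal (MvPolynomial σ K)} (hJ : J ≤ weightIdeal K w hw 1)
    (k : ℕ) : J ^ k ≤ weightIdeal K w hw k := by
  induction k with
  | zero =>
    intro f _ m _
    simpa using Finset.sum_nonneg fun i _ => mul_nonneg (Nat.cast_nonneg (m i)) (hw i)
  | succ k ih =>
    rw [pow_succ, Nat.cast_succ]
    exact (Ideal.mul_mono ih hJ).trans (weightIdeal_mul_le _ _)

end weightIdeal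

/-- **Farkas' lemma** over an ordered field: a linear functional that is nonnegative wherever
finitely many given functionals are is a nonnegative combination of them. -/
theorem farkas_finset {F V ι : Type*} [Field F] [LinearOrder F] [IsStrictOrderedRing F]
    [AddCommGroup V] [Module F V] (s : Finset ι) :
    ∀ (g : ι → V →ₗ[F] F) (f : V →ₗ[F] F),
      (∀ x, (∀ j ∈ s, 0 ≤ g j x) → 0 ≤ f x) →
      ∃ c : ι → F, (∀ j, 0 ≤ c j) ∧ f = ∑ j ∈ s, c j • g j := by
  classical
  induction s using Finset.induction_on with
  | empty =>
    intro g f h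
    refine ⟨0, fun _ => le_rfl, LinearMap.ext fun x => ?_⟩
    have h1 := h x (by simp)
    have h2 := h (-x) (by simp)
    simp only [map_neg] at h2
    simp only [Finset.sum_empty, LinearMap.zero_apply]
    linarith
  | insert m s hm ih =>
    intro g f h
    by_cases hs : ∀ x, (∀ j ∈ s, 0 ≤ g j x) → 0 ≤ f x
    · obtain ⟨c, hc, rfl⟩ := ih g f hs
      refine ⟨Function.update c m 0, fun j => ?_, ?_⟩
      · by_cases hj : j = m
        · simp [hj]
        · simpa [hj] using hc j
      · rw [Finset.sum_insert hm]
        simp only [Function.update_self, zero_smul, zero_add]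
        refine Finset.sum_congr rfl fun j hj => ?_
        rw [Function.update_of_ne (ne_of_mem_of_not_mem hj hm)]
    · push Not at hs
      obtain ⟨x₀, hx₀, hf₀⟩ := hs
      have hg₀ : g m x₀ < 0 := by
        by_contra! hcon
        refine absurd (h x₀ fun j hj => ?_) (not_le.2 hf₀)
        rcases Finset.mem_insert.1 hj with rfl | hj
        exacts [hcon, hx₀ j hj]
      obtain ⟨y, hgy, hy, hfy⟩ : ∃ y, g m y = -1 ∧ (∀ j ∈ s, 0 ≤ g j y) ∧ f y < 0 := by
        have hpos : 0 < (-(g m x₀))⁻¹ := inv_pos.2 (by linarith)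
        refine ⟨(-(g m x₀))⁻¹ • x₀, ?_, fun j hj => ?_, ?_⟩
        · rw [map_smul, smul_eq_mul, inv_neg, neg_mul, inv_mul_cancel₀ hg₀.ne]
        · rw [map_smul, smul_eq_mul]
          exact mul_nonneg hpos.le (hx₀ j hj)
        · rw [map_smul, smul_eq_mul]
          exact mul_neg_of_pos_of_neg hpos hf₀
      obtain ⟨c, hc, hcf⟩ := ih (fun j => g j + g j y • g m) (f + f y • g m) (by
        intro x hx
        have := h (x + g m x • y) (by
          intro j hj
          rcases Finset.mem_insert.1 hj with rfl | hj
          · simp [hgy]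
          · have := hx j hj
            simp only [LinearMap.add_apply, LinearMap.smul_apply, smul_eq_mul] at this
            simp only [map_add, map_smul, smul_eq_mul]
            linarith)
        simp only [map_add, map_smul, smul_eq_mul] at this
        simp only [LinearMap.add_apply, LinearMap.smul_apply, smul_eq_mul]
        linarith)
      have hnn : 0 ≤ ∑ j ∈ s, c j * g j y :=
        Finset.sum_nonneg fun j hj => mul_nonneg (hc j) (hy j hj)
      refine ⟨Function.update c m (∑ j ∈ s, c j * g j y - f y), fun j => ?_, ?_⟩
      · by_cases hj : j = m
        · subst hj
          simp only [Function.update_self]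
          linarith
        · simpa [hj] using hc j
      · rw [Finset.sum_insert hm, Function.update_self]
        have hcong : ∑ j ∈ s, Function.update c m (∑ j ∈ s, c j * g j y - f y) j • g j =
            ∑ j ∈ s, c j • g j := Finset.sum_congr rfl fun j hj => by
          rw [Function.update_of_ne (ne_of_mem_of_not_mem hj hm)]
        rw [hcong]
        refine LinearMap.ext fun x => ?_
        have hx := LinearMap.congr_fun hcf x
        simp only [LinearMap.add_apply, LinearMap.smul_apply, smul_eq_mul, LinearMap.sum_apply,
          mul_add, Finset.sum_add_distrib, ← mul_assoc, ← Finset.sum_mul] at hx ⊢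
        linarith

theorem exists_common_denominator {ι : Type*} [Fintype ι] (β : ι → ℚ) (hβ : ∀ j, 0 ≤ β j) :
    ∃ p : ℕ, 1 ≤ p ∧ ∃ b : ι → ℕ, ∀ j, (b j : ℚ) = p * β j := by
  classical
  refine ⟨∏ j, (β j).den, Finset.prod_pos fun j _ => (β j).den_pos,
    fun j => (β j).num.toNat * ∏ k ∈ Finset.univ.erase j, (β k).den, fun j => ?_⟩
  rw [← Finset.mul_prod_erase _ _ (Finset.mem_univ j)]
  have h1 : (((β j).num.toNat : ℤ) : ℚ) = (β j).num := by
    rw [Int.toNat_of_nonneg (Rat.num_nonneg.2 (hβ j))]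
  have h2 : (β j) * (β j).den = (β j).num := Rat.mul_den_eq_num (β j)
  rw [Int.cast_natCast] at h1
  push_cast
  rw [h1, ← h2]
  ring

section Clutter

variable {n q : ℕ} {E : Fin q → Finset (Fin n)}

theorem mem_coveringPolyhedron_incidence {x : Fin n → ℝ} :
    x ∈ coveringPolyhedron (incidence E) ↔ (∀ i, 0 ≤ x i) ∧ ∀ j, 1 ≤ ∑ i ∈ E j, x i := by
  simp [coveringPolyhedron, incidence]

/-- If `i` is a lower bound of `⟨a, x⟩` on the rational points of the covering polyhedron, then
some fractional packing of edges below `a` has size at least `i`. -/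
theorem exists_packing_of_forall_covering (a : Fin n → ℕ) (i : ℕ)
    (h : ∀ x : Fin n → ℚ, (∀ k, 0 ≤ x k) → (∀ j, 1 ≤ ∑ k ∈ E j, x k) →
      (i : ℚ) ≤ ∑ k, a k * x k) :
    ∃ p : ℕ, 1 ≤ p ∧ ∃ b : Fin q → ℕ, p * i ≤ ∑ j, b j ∧
      ∀ k, ∑ j, (if k ∈ E j then b j else 0) ≤ p * a k := by
  let X (k : Fin n) : ((Fin n → ℚ) × ℚ) →ₗ[ℚ] ℚ := LinearMap.proj k ∘ₗ LinearMap.fst ℚ _ _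
  let T : ((Fin n → ℚ) × ℚ) →ₗ[ℚ] ℚ := LinearMap.snd ℚ _ _
  let g : Fin n ⊕ (Unit ⊕ Fin q) → ((Fin n → ℚ) × ℚ) →ₗ[ℚ] ℚ :=
    Sum.elim X (Sum.elim (fun _ => T) fun j => ∑ k ∈ E j, X k - T)
  obtain ⟨c, hc, hcf⟩ := farkas_finset Finset.univ g (∑ k, (a k : ℚ) • X k - (i : ℚ) • T) (by
    rintro ⟨x, t⟩ hx
    have hx0 (k : Fin n) : 0 ≤ x k := hx (Sum.inl k) (Finset.mem_univ _)
    have ht : 0 ≤ t := hx (Sum.inr (Sum.inl ())) (Finset.mem_univ _)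
    have hj (j : Fin q) : t ≤ ∑ k ∈ E j, x k := by
      have := hx (Sum.inr (Sum.inr j)) (Finset.mem_univ _)
      simpa [g, X, T] using this
    suffices (i : ℚ) * t ≤ ∑ k, a k * x k by simpa [X, T] using this
    rcases ht.eq_or_lt with rfl | ht
    · simpa using Finset.sum_nonneg fun k _ => mul_nonneg (Nat.cast_nonneg (a k)) (hx0 k)
    · have := h (fun k => x k / t) (fun k => div_nonneg (hx0 k) ht.le) (fun j => by
        rw [← Finset.sum_div, le_div_iff₀ ht, one_mul]
        exact hj j)
      simp only [← mul_div_assoc, ← Finset.sum_div] at this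
      rwa [le_div_iff₀ ht] at this)
  obtain ⟨p, hp, b, hb⟩ := exists_common_denominator (fun j => c (Sum.inr (Sum.inr j)))
    fun j => hc _
  have hp0 : (0 : ℚ) ≤ p := Nat.cast_nonneg p
  refine ⟨p, hp, b, ?_, fun k => ?_⟩
  · have := LinearMap.congr_fun hcf (0, 1)
    simp [g, X, T] at this
    have h1 := hc (Sum.inr (Sum.inl ()))
    have h2 : (i : ℚ) ≤ ∑ j, c (Sum.inr (Sum.inr j)) := by linarith
    have h3 := mul_le_mul_of_nonneg_left h2 hp0
    rw [Finset.mul_sum, ← Finset.sum_congr rfl fun j _ => hb j] at h3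
    exact_mod_cast h3
  · have := LinearMap.congr_fun hcf (Pi.single k 1, 0)
    simp [g, X, T, Pi.single_apply] at this
    have h1 := hc (Sum.inl k)
    have h2 : ∑ j, (if k ∈ E j then c (Sum.inr (Sum.inr j)) else 0) ≤ (a k : ℚ) := by linarith
    have h3 := mul_le_mul_of_nonneg_left h2 hp0
    simp only [Finset.mul_sum, mul_ite, mul_zero, ← hb] at h3
    exact_mod_cast h3

/-- `C` is a vertex cover of the clutter with edges `E`. -/
def IsVertexCover (E : Fin q → Finset (Fin n)) (C : Finset (Fin n)) : Prop :=
  ∀ j, ∃ i ∈ E j, i ∈ C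

/-- The characteristic vector of `C`. -/
def charVec (C : Finset (Fin n)) : Fin n → ℝ := fun i => if i ∈ C then 1 else 0

theorem charVec_nonneg (C : Finset (Fin n)) (i : Fin n) : 0 ≤ charVec C i := by
  unfold charVec
  split_ifs <;> simp

theorem IsVertexCover.charVec_mem {C : Finset (Fin n)} (hC : IsVertexCover E C) :
    charVec C ∈ coveringPolyhedron (incidence E) := by
  refine mem_coveringPolyhedron_incidence.2 ⟨charVec_nonneg C, fun j => ?_⟩
  obtain ⟨i, hi, hiC⟩ := hC j
  calc (1 : ℝ) = charVec C i := by simp [charVec, hiC]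
    _ ≤ _ := Finset.single_le_sum (fun k _ => charVec_nonneg C k) hi

theorem convex_coveringPolyhedron : Convex ℝ (coveringPolyhedron (incidence E)) := by
  intro x hx y hy s t hs ht hst
  rw [mem_coveringPolyhedron_incidence] at *
  refine ⟨fun i => ?_, fun j => ?_⟩
  · exact add_nonneg (mul_nonneg hs (hx.1 i)) (mul_nonneg ht (hy.1 i))
  · have h1 := mul_le_mul_of_nonneg_left (hx.2 j) hs
    have h2 := mul_le_mul_of_nonneg_left (hy.2 j) ht
    simp only [Pi.add_apply, Pi.smul_apply, smul_eq_mul, Finset.sum_add_distrib,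
      ← Finset.mul_sum]
    linarith

theorem isClosed_coveringPolyhedron : IsClosed (coveringPolyhedron (incidence E)) := by
  have : coveringPolyhedron (incidence E) =
      (⋂ i, {x | 0 ≤ x i}) ∩ ⋂ j, {x | 1 ≤ ∑ i ∈ E j, x i} := by
    ext x
    simp [mem_coveringPolyhedron_incidence]
  rw [this]
  refine (isClosed_iInter fun i => ?_).inter (isClosed_iInter fun j => ?_)
  · exact isClosed_le continuous_const (continuous_apply i)
  · exact isClosed_le continuous_const (by fun_prop)

theorem inf_one_mem_coveringPolyhedron {x : Fin n → ℝ}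
    (hx : x ∈ coveringPolyhedron (incidence E)) :
    x ⊓ 1 ∈ coveringPolyhedron (incidence E) := by
  rw [mem_coveringPolyhedron_incidence] at *
  have hnn (i : Fin n) : 0 ≤ (x ⊓ 1) i := le_inf (hx.1 i) zero_le_one
  refine ⟨hnn, fun j => ?_⟩
  by_cases h : ∃ i ∈ E j, 1 ≤ x i
  · obtain ⟨i, hi, h1⟩ := h
    calc (1 : ℝ) = (x ⊓ 1) i := by simp [h1]
      _ ≤ _ := Finset.single_le_sum (fun k _ => hnn k) hi
  · push Not at h
    refine (hx.2 j).trans_eq (Finset.sum_congr rfl fun i hi => ?_)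
    simp [(h i hi).le]

/-- A linear functional with positive coefficients is minimized over the covering polyhedron at
an extreme point contained in the unit cube. -/
theorem exists_extremePoint_le (a : Fin n → ℝ) (ha : ∀ k, 0 < a k) {x : Fin n → ℝ}
    (hx : x ∈ coveringPolyhedron (incidence E)) :
    ∃ e ∈ Set.extremePoints ℝ (coveringPolyhedron (incidence E)),
      (∀ k, e k ≤ 1) ∧ ∑ k, a k * e k ≤ ∑ k, a k * x k := by
  let L : StrongDual ℝ (Fin n → ℝ) := ∑ k, (-a k) • ContinuousLinearMap.proj k
  have hL (y : Fin n → ℝ) : L y = -∑ k, a k * y k := by simp [L]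
  let P := coveringPolyhedron (incidence E) ∩ Set.Icc 0 1
  have hPc : IsCompact P := isCompact_Icc.inter_left isClosed_coveringPolyhedron
  have hmem {y : Fin n → ℝ} (hy : y ∈ coveringPolyhedron (incidence E)) : y ⊓ 1 ∈ P :=
    ⟨inf_one_mem_coveringPolyhedron hy,
      fun i => (mem_coveringPolyhedron_incidence.1 (inf_one_mem_coveringPolyhedron hy)).1 i,
      inf_le_right⟩
  have hexp : IsExposed ℝ P (L.toExposed P) := ContinuousLinearMap.toExposed.isExposed
  have hne : (L.toExposed P).Nonempty := by
    obtain ⟨y, hy, hmax⟩ := hPc.exists_isMaxOn ⟨_, hmem hx⟩ L.continuous.continuousOn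
    exact ⟨y, hy, hmax⟩
  obtain ⟨e, he⟩ := (hexp.isCompact hPc).extremePoints_nonempty hne
  have heP : e ∈ P := he.1.1
  have hmin (y : Fin n → ℝ) (hy : y ∈ coveringPolyhedron (incidence E)) :
      ∑ k, a k * e k ≤ ∑ k, a k * (y ⊓ 1) k := by
    have := he.1.2 _ (hmem hy)
    rw [hL, hL] at this
    linarith
  have hle (y : Fin n → ℝ) : ∑ k, a k * (y ⊓ 1) k ≤ ∑ k, a k * y k :=
    Finset.sum_le_sum fun k _ => mul_le_mul_of_nonneg_left inf_le_left (ha k).le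
  have heext : e ∈ P.extremePoints ℝ := hexp.isExtreme.extremePoints_subset_extremePoints he
  refine ⟨e, ⟨heP.1, fun y hy z hz hseg => ?_⟩, heP.2.2, (hmin x hx).trans (hle x)⟩
  obtain ⟨s, t, hs, ht, hst, hsum⟩ := hseg
  have hsplit : ∑ k, a k * e k = s * ∑ k, a k * y k + t * ∑ k, a k * z k := by
    rw [← hsum, Finset.mul_sum, Finset.mul_sum, ← Finset.sum_add_distrib]
    refine Finset.sum_congr rfl fun k _ => ?_
    simp only [Pi.add_apply, Pi.smul_apply, smul_eq_mul]
    ring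
  have hone : ∑ k, a k * e k = s * ∑ k, a k * e k + t * ∑ k, a k * e k := by
    rw [← add_mul, hst, one_mul]
  have hy1 := hmin y hy
  have hz1 := hmin z hz
  have hy2 := hle y
  have hz2 := hle z
  have key (u : Fin n → ℝ) (hu : ∑ k, a k * u k ≤ ∑ k, a k * (u ⊓ 1) k) : u ⊓ 1 = u := by
    have heq := (Finset.sum_eq_sum_iff_of_le fun k _ =>
      mul_le_mul_of_nonneg_left (inf_le_left : (u ⊓ 1) k ≤ u k) (ha k).le).1
        (le_antisymm (hle u) hu)
    funext k
    exact mul_left_cancel₀ (ha k).ne' (heq k (Finset.mem_univ k))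
  have hyP : y ⊓ 1 = y := key y (by
    by_contra! hcon
    linarith [mul_lt_mul_of_pos_left (hy1.trans_lt hcon) hs,
      mul_le_mul_of_nonneg_left (hz1.trans hz2) ht.le])
  have hzP : z ⊓ 1 = z := key z (by
    by_contra! hcon
    linarith [mul_lt_mul_of_pos_left (hz1.trans_lt hcon) ht,
      mul_le_mul_of_nonneg_left (hy1.trans hy2) hs.le])
  exact heext.2 (hyP ▸ hmem hy) (hzP ▸ hmem hz) ⟨s, t, hs, ht, hst, hsum⟩

/-- If the covering polyhedron is integral, a bound valid for all vertex covers is valid on the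
whole polyhedron. -/
theorem IntegralPolyhedron.le_of_forall_cover (hint : IntegralPolyhedron (incidence E))
    (a : Fin n → ℕ) (i : ℝ)
    (h : ∀ C, IsVertexCover E C → i ≤ ∑ k, (a k : ℝ) * charVec C k) {x : Fin n → ℝ}
    (hx : x ∈ coveringPolyhedron (incidence E)) : i ≤ ∑ k, (a k : ℝ) * x k := by
  refine le_of_forall_pos_le_add fun ε hε => ?_
  have hx0 := (mem_coveringPolyhedron_incidence.1 hx).1
  have hS : 0 ≤ ∑ k, x k := Finset.sum_nonneg fun k _ => hx0 k
  set δ := ε / (∑ k, x k + 1) with hδ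
  have hδ0 : 0 < δ := by positivity
  obtain ⟨e, he, he1, hle⟩ := exists_extremePoint_le (fun k => (a k : ℝ) + δ)
    (fun k => by positivity) hx
  obtain ⟨he0, heE⟩ := mem_coveringPolyhedron_incidence.1 he.1
  have h01 (k : Fin n) : e k = 0 ∨ e k = 1 := by
    obtain ⟨z, hz⟩ := hint e he k
    have h0 := he0 k
    have h1 := he1 k
    rw [hz] at h0 h1 ⊢
    norm_cast at *
    omega
  let C : Finset (Fin n) := Finset.univ.filter fun k => e k = 1
  have heC : e = charVec C := by
    funext k
    rcases h01 k with h | h <;> simp [charVec, C, h]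
  have hC : IsVertexCover E C := by
    intro j
    by_contra! hcon
    have hzero : ∑ k ∈ E j, e k = 0 := Finset.sum_eq_zero fun k hk =>
      (h01 k).resolve_right fun h1 => hcon k hk (by simp [C, h1])
    have := heE j
    linarith
  have hCi := h C hC
  rw [← heC] at hCi
  simp only [add_mul, Finset.sum_add_distrib, ← Finset.mul_sum] at hle
  have h3 : 0 ≤ δ * ∑ k, e k := mul_nonneg hδ0.le (Finset.sum_nonneg fun k _ => he0 k)
  have h4 : δ * ∑ k, x k ≤ ε := by
    rw [hδ, div_mul_eq_mul_div, div_le_iff₀ (by linarith)]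
    nlinarith
  linarith

/-- The covering polyhedron is integral if every integral linear inequality with nonnegative
coefficients valid for all vertex covers is valid on the whole polyhedron. -/
theorem integralPolyhedron_of_forall_le
    (h : ∀ (a : Fin n → ℕ) (i : ℕ), 1 ≤ i →
      (∀ C, IsVertexCover E C → (i : ℝ) ≤ ∑ k, (a k : ℝ) * charVec C k) →
      ∀ x ∈ coveringPolyhedron (incidence E), (i : ℝ) ≤ ∑ k, (a k : ℝ) * x k) :
    IntegralPolyhedron (incidence E) := by
  intro x hx
  have hx0 := (mem_coveringPolyhedron_incidence.1 hx.1).1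
  let D : Set (Fin n → ℝ) := charVec '' {C | IsVertexCover E C}
  have hD : D.Finite := (Set.toFinite _).image _
  have hDQ : convexHull ℝ D ⊆ coveringPolyhedron (incidence E) := by
    refine convexHull_min ?_ convex_coveringPolyhedron
    rintro _ ⟨C, hC, rfl⟩
    exact IsVertexCover.charVec_mem hC
  suffices hz : ∃ z ∈ convexHull ℝ D, z ≤ x by
    obtain ⟨z, hzD, hzx⟩ := hz
    have hzQ := hDQ hzD
    have hwQ : x + (x - z) ∈ coveringPolyhedron (incidence E) := by
      obtain ⟨h1, h2⟩ := mem_coveringPolyhedron_incidence.1 hx.1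
      refine mem_coveringPolyhedron_incidence.2 ⟨fun k => ?_, fun j => ?_⟩
      · exact add_nonneg (h1 k) (sub_nonneg.2 (hzx k))
      · refine (h2 j).trans (Finset.sum_le_sum fun k _ => ?_)
        simpa using hzx k
    have hzeq : z = x := hx.2 hzQ hwQ ⟨1 / 2, 1 / 2, by norm_num, by norm_num, by norm_num, by
      funext k
      simp only [Pi.add_apply, Pi.sub_apply, Pi.smul_apply, smul_eq_mul]
      ring⟩
    have hxext : x ∈ (convexHull ℝ D).extremePoints ℝ :=
      inter_extremePoints_subset_extremePoints_of_subset hDQ ⟨hzeq ▸ hzD, hx⟩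
    have hxD : x ∈ D := extremePoints_convexHull_subset hxext
    obtain ⟨C, -, rfl⟩ := hxD
    intro k
    by_cases hk : k ∈ C
    · exact ⟨1, by simp [charVec, hk]⟩
    · exact ⟨0, by simp [charVec, hk]⟩
  by_contra! hcon
  obtain ⟨f, u, v, hu, huv, hv⟩ := geometric_hahn_banach_compact_closed (convex_convexHull ℝ D)
    (hD.isCompact_convexHull ℝ) (convex_Iic x) isClosed_Iic
    (Set.disjoint_left.2 fun z hz hzx => hcon z hz hzx)
  let a (k : Fin n) : ℝ := -f (Pi.single k 1)
  have hf (y : Fin n → ℝ) : f y = -∑ k, a k * y k := by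
    conv_lhs => rw [pi_eq_sum_univ' y]
    simp [a, mul_comm]
  have ha (k : Fin n) : 0 ≤ a k := by
    by_contra! hneg
    have hr : 0 ≤ (f x - v) / (-a k) :=
      div_nonneg (by linarith [hv x Set.self_mem_Iic]) (by linarith)
    have hmem : x - ((f x - v) / (-a k)) • Pi.single k (1 : ℝ) ∈ Set.Iic x := by
      refine sub_le_self x fun l => ?_
      by_cases hl : l = k
      · subst hl
        simpa using hr
      · simp [hl]
    have := hv _ hmem
    rw [map_sub, map_smul, smul_eq_mul, show f (Pi.single k 1) = -a k by simp [a],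
      div_mul_cancel₀ _ (by linarith : -a k ≠ 0)] at this
    linarith
  have hxv : ∑ k, a k * x k < -v := by
    have := hv x Set.self_mem_Iic
    rw [hf] at this
    linarith
  have hCv (C : Finset (Fin n)) (hC : IsVertexCover E C) : -v ≤ ∑ k, a k * charVec C k := by
    have := hu _ (subset_convexHull ℝ D ⟨C, hC, rfl⟩)
    rw [hf] at this
    linarith
  have hv0 : 0 < -v :=
    (Finset.sum_nonneg fun k _ => mul_nonneg (ha k) (hx0 k)).trans_lt hxv
  obtain ⟨N, hN⟩ := exists_nat_gt ((∑ k, x k) / (-v - ∑ k, a k * x k))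
  rw [div_lt_iff₀ (by linarith)] at hN
  have hN0 : (0 : ℝ) < N := by
    rcases Nat.eq_zero_or_pos N with rfl | hpos
    · have := Finset.sum_nonneg fun k (_ : k ∈ Finset.univ) => hx0 k
      simp only [Nat.cast_zero, zero_mul] at hN
      linarith
    · exact_mod_cast hpos
  have hbound := h (fun k => ⌈N * a k⌉₊) ⌈N * -v⌉₊
    (Nat.one_le_iff_ne_zero.2 (Nat.ceil_pos.2 (mul_pos hN0 hv0)).ne') (fun C hC => by
      have h1 : N * -v ≤ ∑ k, (⌈N * a k⌉₊ : ℝ) * charVec C k := by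
        refine (mul_le_mul_of_nonneg_left (hCv C hC) hN0.le).trans ?_
        rw [Finset.mul_sum]
        refine Finset.sum_le_sum fun k _ => ?_
        rw [← mul_assoc]
        exact mul_le_mul_of_nonneg_right (Nat.le_ceil _) (charVec_nonneg C k)
      have h2 : ∑ k, (⌈N * a k⌉₊ : ℝ) * charVec C k =
          ((∑ k, if k ∈ C then ⌈N * a k⌉₊ else 0 : ℕ) : ℝ) := by
        simp [charVec]
      rw [h2] at h1 ⊢
      exact_mod_cast Nat.ceil_le.2 h1) x hx.1
  have hup : ∑ k, (⌈N * a k⌉₊ : ℝ) * x k ≤ N * (∑ k, a k * x k) + ∑ k, x k := by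
    rw [Finset.mul_sum, ← Finset.sum_add_distrib]
    refine Finset.sum_le_sum fun k _ => ?_
    have := (Nat.ceil_lt_add_one (mul_nonneg hN0.le (ha k))).le
    nlinarith [mul_le_mul_of_nonneg_right this (hx0 k)]
  have := Nat.le_ceil (N * -v)
  nlinarith

open MvPolynomial in
/-- The ideals generated by sets of variables are prime. -/
theorem isPrime_span_X_image {σ : Type*} (K : Type*) [Field K] (s : Set σ) :
    (Ideal.span (X '' s : Set (MvPolynomial σ K))).IsPrime := by
  classical
  let φ : MvPolynomial σ K →ₐ[K] MvPolynomial σ K := aeval fun i => if i ∈ s then 0 else X i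
  have hφ : Ideal.span (X '' s) = RingHom.ker φ := by
    refine le_antisymm (Ideal.span_le.2 ?_) fun f hf => ?_
    · rintro _ ⟨i, hi, rfl⟩
      simp [φ, hi]
    · let π := Ideal.Quotient.mkₐ K (Ideal.span (X '' s : Set (MvPolynomial σ K)))
      have hπ : π.comp φ = π := by
        refine MvPolynomial.algHom_ext fun i => ?_
        by_cases hi : i ∈ s
        · have : π (X i) = 0 :=
            Ideal.Quotient.eq_zero_iff_mem.2 (Ideal.subset_span ⟨i, hi, rfl⟩)
          simp [φ, hi, this]
        · simp [φ, hi]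
      refine Ideal.Quotient.eq_zero_iff_mem.1 ?_
      have := DFunLike.congr_fun hπ f
      rw [AlgHom.comp_apply, (RingHom.mem_ker).1 hf, map_zero] at this
      exact this.symm
  rw [hφ]
  exact RingHom.ker_isPrime _

variable {K : Type*} [Field K]

/-- The edge ideal of the clutter with edges `E`. -/
noncomputable def edgeIdeal (K : Type*) [Field K] (E : Fin q → Finset (Fin n)) :
    Ideal (MvPolynomial (Fin n) K) :=
  Ideal.span (Set.range fun j => ∏ i ∈ E j, MvPolynomial.X i)

theorem prod_X_eq_monomial (s : Finset (Fin n)) :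
    ∏ i ∈ s, (MvPolynomial.X i : MvPolynomial (Fin n) K) =
      MvPolynomial.monomial (∑ i ∈ s, Finsupp.single i 1) 1 := by
  rw [MvPolynomial.monomial_sum_one]
  rfl

theorem edgeIdeal_le_weightIdeal {w : Fin n → ℝ}
    (hw : w ∈ coveringPolyhedron (incidence E)) :
    edgeIdeal K E ≤ weightIdeal K w hw.1 1 := by
  refine Ideal.span_le.2 ?_
  rintro _ ⟨j, rfl⟩
  simp only [SetLike.mem_coe]
  rw [prod_X_eq_monomial, monomial_mem_weightIdeal]
  simpa [Finsupp.single_apply] using (mem_coveringPolyhedron_incidence.1 hw).2 j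

theorem monomialIntClosure_le_weightIdeal {w : Fin n → ℝ}
    (hw : w ∈ coveringPolyhedron (incidence E)) (i : ℕ) :
    monomialIntClosure (edgeIdeal K E) i ≤ weightIdeal K w hw.1 i := by
  refine Ideal.span_le.2 ?_
  rintro _ ⟨a, rfl, p, hp, hmem⟩
  have h := pow_le_weightIdeal (edgeIdeal_le_weightIdeal hw) _ hmem
  rw [MvPolynomial.monomial_pow, one_pow, monomial_mem_weightIdeal] at h
  rw [SetLike.mem_coe, monomial_mem_weightIdeal]
  have hp' : (0 : ℝ) < p := by exact_mod_cast hp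
  simp only [Finsupp.smul_apply, smul_eq_mul, Nat.cast_mul, mul_assoc, ← Finset.mul_sum] at h
  exact le_of_mul_le_mul_left h hp'

theorem span_X_image_pow_eq_weightIdeal (C : Finset (Fin n)) (i : ℕ) :
    Ideal.span (MvPolynomial.X '' (C : Set (Fin n)) : Set (MvPolynomial (Fin n) K)) ^ i =
      weightIdeal K (charVec C) (charVec_nonneg C) i := by
  refine le_antisymm (pow_le_weightIdeal (Ideal.span_le.2 ?_) i) fun f hf => ?_
  · rintro _ ⟨k, hk, rfl⟩
    rw [SetLike.mem_coe, MvPolynomial.X, monomial_mem_weightIdeal]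
    simp [Finsupp.single_apply, charVec, Finset.mem_coe.1 hk]
  · rw [f.as_sum]
    refine Ideal.sum_mem _ fun m hm => ?_
    have hle : i ≤ ∑ k ∈ C, m k := by
      have := hf m hm
      simp only [charVec, mul_ite, mul_one, mul_zero, Finset.sum_ite_mem, Finset.univ_inter]
        at this
      exact_mod_cast this
    rw [MvPolynomial.monomial_eq, Finsupp.prod_fintype _ _ (by simp)]
    refine Ideal.mul_mem_left _ _ (Ideal.mem_of_dvd _
      (Finset.prod_dvd_prod_of_subset _ _ _ (Finset.subset_univ C)) ?_)
    refine Ideal.pow_le_pow_right hle ?_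
    rw [← Finset.prod_pow_eq_pow_sum]
    exact Ideal.prod_mem_prod fun k hk =>
      Ideal.pow_mem_pow (Ideal.subset_span (Set.mem_image_of_mem _ hk)) _

theorem mem_symbolicPower_edgeIdeal {f : MvPolynomial (Fin n) K} {i : ℕ} :
    f ∈ symbolicPower (edgeIdeal K E) i ↔ ∀ C, IsVertexCover E C →
      ∀ m ∈ f.support, (i : ℝ) ≤ ∑ k, (m k : ℝ) * charVec C k := by
  have hle (C : Finset (Fin n)) (hC : IsVertexCover E C) :
      edgeIdeal K E ≤ Ideal.span (MvPolynomial.X '' (C : Set (Fin n))) := by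
    refine Ideal.span_le.2 ?_
    rintro _ ⟨j, rfl⟩
    obtain ⟨k, hk, hkC⟩ := hC j
    exact Ideal.mem_of_dvd _ (Finset.dvd_prod_of_mem MvPolynomial.X hk)
      (Ideal.subset_span (Set.mem_image_of_mem _ hkC))
  simp only [symbolicPower, Submodule.mem_iInf]
  constructor
  · intro hf C hC
    have := isPrime_span_X_image K (C : Set (Fin n))
    obtain ⟨p, hp, hpC⟩ := Ideal.exists_minimalPrimes_le (hle C hC)
    have hfC := Ideal.pow_right_mono hpC i (hf p hp)
    rwa [span_X_image_pow_eq_weightIdeal] at hfC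
  · classical
    intro hf p hp
    have hprime := hp.1.1
    let C : Finset (Fin n) := Finset.univ.filter fun k => MvPolynomial.X k ∈ p
    have hC : IsVertexCover E C := by
      intro j
      have hj : ∏ k ∈ E j, MvPolynomial.X k ∈ p := hp.1.2 (Ideal.subset_span ⟨j, rfl⟩)
      obtain ⟨k, hk, hkp⟩ := (Ideal.IsPrime.prod_mem_iff).1 hj
      exact ⟨k, hk, by simp [C, hkp]⟩
    have hCp : Ideal.span (MvPolynomial.X '' (C : Set (Fin n))) ≤ p := by
      refine Ideal.span_le.2 ?_
      rintro _ ⟨k, hk, rfl⟩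
      simpa [C] using hk
    refine Ideal.pow_right_mono hCp i ?_
    rw [span_X_image_pow_eq_weightIdeal]
    exact hf C hC

theorem monomial_mem_edgeIdeal_pow {a : Fin n →₀ ℕ} {b : Fin q → ℕ}
    (h : ∀ k, ∑ j, (if k ∈ E j then b j else 0) ≤ a k) :
    MvPolynomial.monomial a (1 : K) ∈ edgeIdeal K E ^ ∑ j, b j := by
  have hle : ∑ j, b j • ∑ k ∈ E j, Finsupp.single k 1 ≤ a := by
    intro k
    simpa [Finsupp.finsetSum_apply, Finsupp.single_apply] using h k
  refine Ideal.mem_of_dvd _ (MvPolynomial.monomial_dvd_monomial.2 ⟨Or.inr hle, one_dvd _⟩) ?_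
  rw [MvPolynomial.monomial_sum_one, ← Finset.prod_pow_eq_pow_sum]
  refine Ideal.prod_mem_prod fun j _ => ?_
  have hpow : MvPolynomial.monomial (b j • ∑ k ∈ E j, Finsupp.single k 1) (1 : K) =
      (∏ k ∈ E j, MvPolynomial.X k) ^ b j := by
    rw [prod_X_eq_monomial, MvPolynomial.monomial_pow, one_pow]
  rw [hpow]
  exact Ideal.pow_mem_pow (Ideal.subset_span (Set.mem_range_self j)) _

theorem monomial_mem_monomialIntClosure {a : Fin n →₀ ℕ} {i : ℕ}
    (h : ∀ x ∈ coveringPolyhedron (incidence E), (i : ℝ) ≤ ∑ k, (a k : ℝ) * x k) :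
    MvPolynomial.monomial a (1 : K) ∈ monomialIntClosure (edgeIdeal K E) i := by
  obtain ⟨p, hp, b, hb, hba⟩ := exists_packing_of_forall_covering (E := E) a i
    fun x hx hxE => by
      have := h (fun k => (x k : ℝ)) (mem_coveringPolyhedron_incidence.2
        ⟨fun k => by exact_mod_cast hx k, fun j => by exact_mod_cast hxE j⟩)
      exact_mod_cast this
  refine Ideal.subset_span ⟨a, rfl, p, hp, Ideal.pow_le_pow_right hb ?_⟩
  rw [MvPolynomial.monomial_pow, one_pow]
  exact monomial_mem_edgeIdeal_pow fun k => by simpa using hba k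

theorem monomialIntClosure_le_symbolicPower (i : ℕ) :
    monomialIntClosure (edgeIdeal K E) i ≤ symbolicPower (edgeIdeal K E) i := fun _ hf =>
  mem_symbolicPower_edgeIdeal.2 fun _ hC =>
    mem_weightIdeal.1 (monomialIntClosure_le_weightIdeal hC.charVec_mem i hf)

end Clutter

/-- Let `𝒞` be a clutter with incidence matrix `A` and edge ideal
`I = I(𝒞) ⊆ R = K[x₁, …, xₙ]`.  Then the set covering polyhedron `Q(A)` is an integral
polyhedron if and only if for every `i ≥ 1` the integral closure of `Iⁱ` equals the `i`-th
symbolic power `I^{(i)} = 𝔭₁ⁱ ∩ ⋯ ∩ 𝔭_sⁱ`, where `𝔭₁, …, 𝔭_s` are the minimal primes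
of `I`. -/
theorem stmt12 {n q : ℕ} (K : Type*) [Field K] (E : Fin q → Finset (Fin n))
    (hE : IsClutter E) (I : Ideal (MvPolynomial (Fin n) K))
    (hI : I = Ideal.span (Set.range fun j => ∏ i ∈ E j, MvPolynomial.X i)) :
    IntegralPolyhedron (incidence E) ↔
      ∀ i : ℕ, 1 ≤ i → monomialIntClosure I i = symbolicPower I i := by
  subst hI
  change _ ↔ ∀ i : ℕ, 1 ≤ i →
    monomialIntClosure (edgeIdeal K E) i = symbolicPower (edgeIdeal K E) i
  constructor
  · intro hint i _
    refine le_antisymm (monomialIntClosure_le_symbolicPower i) fun f hf => ?_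
    rw [mem_symbolicPower_edgeIdeal] at hf
    rw [f.as_sum]
    refine Ideal.sum_mem _ fun m hm => ?_
    rw [← mul_one (MvPolynomial.coeff m f), ← MvPolynomial.C_mul_monomial]
    exact Ideal.mul_mem_left _ _ (monomial_mem_monomialIntClosure fun x hx =>
      hint.le_of_forall_cover m i (fun C hC => hf C hC m hm) hx)
  · intro heq
    refine integralPolyhedron_of_forall_le fun a i hi hC x hx => ?_
    have hmem : MvPolynomial.monomial (Finsupp.equivFunOnFinite.symm a) (1 : K) ∈
        symbolicPower (edgeIdeal K E) i := by
      classical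
      rw [mem_symbolicPower_edgeIdeal]
      intro C hcov m hm
      rw [MvPolynomial.support_monomial, if_neg one_ne_zero, Finset.mem_singleton] at hm
      subst hm
      simpa using hC C hcov
    rw [← heq i hi] at hmem
    simpa using monomial_mem_weightIdeal.1 (monomialIntClosure_le_weightIdeal hx i hmem)
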